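/- arXiv:1801.02287 — 5 statements merged into one kernel-verified Lean document; each statement's English description precedes it below -/
import Mathlib

section
/- Let L ≥ 1 and nI ≥ 1 be integers, and let ω_1, …, ω_L be integers with 0 ≤ ω_l ≤ nI for every l. Set k = Σ_{l=1}^{L} ω_l, q = ⌊k/nI⌋ and r = k mod nI. Then Σ_{l=1}^{L} ω_l² ≤ q·nI² + r². (That is, among all contact vectors summing to k with entries bounded by nI, the sum of squares is maximized by the vector having q entries equal to nI, one entry equal to r, and the rest zero.) -/
/-- Adding one entry `a ≤ n` to a partial sum `k` raises the extremal value
`(k / n) n² + (k mod n)²` by at least `a²`. -/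
theorem sq_add_div_mul_sq_add_mod_sq_le {n a : ℕ} (hn : 0 < n) (ha : a ≤ n) (k : ℕ) :
    a ^ 2 + (k / n * n ^ 2 + (k % n) ^ 2) ≤ (a + k) / n * n ^ 2 + ((a + k) % n) ^ 2 := by
  have hr := Nat.mod_lt k hn
  have hk := Nat.div_add_mod k n
  generalize k / n = q at *
  generalize k % n = r at *
  subst hk
  rcases lt_or_ge (a + r) n with h | h
  · have e : a + (n * q + r) = (a + r) + n * q := by ring
    rw [e, Nat.add_mul_div_left _ _ hn, Nat.add_mul_mod_self_left, Nat.div_eq_of_lt h,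
      Nat.mod_eq_of_lt h]
    nlinarith [Nat.zero_le (a * r)]
  · obtain ⟨s, hs⟩ := Nat.exists_eq_add_of_le h
    have hsn : s < n := by omega
    have hsa : s ≤ a := by omega
    have e : a + (n * q + r) = s + n * (q + 1) := by linear_combination hs
    rw [e, Nat.add_mul_div_left _ _ hn, Nat.add_mul_mod_self_left, Nat.div_eq_of_lt hsn,
      Nat.mod_eq_of_lt hsn]
    obtain ⟨d, rfl⟩ := Nat.exists_eq_add_of_le ha
    obtain rfl : r = d + s := by omega
    nlinarith [Nat.mul_le_mul_left d hsa]

theorem Finset.sum_sq_le_div_mul_sq_add_mod_sq {ι : Type*} {n : ℕ} (hn : 0 < n)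
    (s : Finset ι) (f : ι → ℕ) (hf : ∀ i ∈ s, f i ≤ n) :
    ∑ i ∈ s, f i ^ 2 ≤ (∑ i ∈ s, f i) / n * n ^ 2 + ((∑ i ∈ s, f i) % n) ^ 2 := by
  induction s using Finset.cons_induction with
  | empty => simp
  | cons i s hi ih =>
    rw [Finset.sum_cons, Finset.sum_cons]
    exact (Nat.add_le_add_left (ih fun j hj => hf j (Finset.mem_cons_of_mem hj)) _).trans
      (sq_add_div_mul_sq_add_mod_sq_le hn (hf i (Finset.mem_cons_self i s)) _)

/-- Among all contact vectors summing to `k` with entries bounded by `nI`, the sum of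
squares is at most `q nI² + r²` where `q = ⌊k/nI⌋` and `r = k mod nI`. -/
theorem contact_vector_sum_sq_le (L nI : ℕ) (hL : 1 ≤ L) (hnI : 1 ≤ nI)
    (ω : Fin L → ℕ) (hω : ∀ l, ω l ≤ nI)
    (k q r : ℕ) (hk : k = ∑ l, ω l) (hq : q = k / nI) (hr : r = k % nI) :
    ∑ l, (ω l) ^ 2 ≤ q * nI ^ 2 + r ^ 2 := by
  subst hq hr hk
  exact Finset.univ.sum_sq_le_div_mul_sq_add_mod_sq hnI ω fun l _ => hω l
end

section
/- In the Algorithm-1 storage structure with L ≥ 1 and nI ≥ 2, let S be any set of k distinct nodes and for each l ∈ {1,…,L} let ω_l be the number of nodes of S in cluster l. Then the number of distinct coded symbols stored on at least one node of S equals k(nI − 1) − Σ_{l=1}^{L} ω_l(ω_l − 1)/2. -/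
open Finset in
/-- Adding a node `v` to `S` retrieves exactly the edges joining `v` to the nodes of its cluster
outside `insert v S`. -/
theorem filter_exists_mem_insert {ι α : Type*} [Fintype ι] [Fintype α] [DecidableEq ι]
    [DecidableEq α] (v : ι × α) (S : Finset (ι × α)) :
    (univ.filter fun s : ι × Sym2 α =>
        ¬ s.2.IsDiag ∧ ∃ w ∈ insert v S, w.1 = s.1 ∧ w.2 ∈ s.2) =
      (univ.filter fun s : ι × Sym2 α => ¬ s.2.IsDiag ∧ ∃ w ∈ S, w.1 = s.1 ∧ w.2 ∈ s.2) ∪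
        (univ.filter fun j : α => (v.1, j) ∉ insert v S).image fun j => (v.1, s(v.2, j)) := by
  obtain ⟨l, a⟩ := v
  ext ⟨m, e⟩
  simp only [mem_filter, mem_univ, true_and, mem_union, mem_image, Prod.mk.injEq,
    exists_mem_insert]
  constructor
  · rintro ⟨hd, ⟨rfl, ha⟩ | h⟩
    · obtain ⟨b, rfl⟩ := ha
      by_cases hb : (l, b) ∈ S
      · exact Or.inl ⟨hd, (l, b), hb, rfl, Sym2.mem_mk_right a b⟩
      · refine Or.inr ⟨b, ?_, rfl, rfl⟩
        rw [Sym2.mk_isDiag_iff] at hd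
        simp [hb, Ne.symm hd]
    · exact Or.inl ⟨hd, h⟩
  · rintro (⟨hd, h⟩ | ⟨b, hb, rfl, rfl⟩)
    · exact ⟨hd, Or.inr h⟩
    · simp only [mem_insert, Prod.mk.injEq, true_and, not_or] at hb
      exact ⟨by simpa using Ne.symm hb.1, Or.inl ⟨rfl, Sym2.mem_mk_left a b⟩⟩

open Finset in
/-- Edges retrieved by `S`, plus edges counted twice, is the total number of stored copies. -/
theorem card_retrieved_add_sum_choose_two {ι α : Type*} [Fintype ι] [Fintype α] [DecidableEq ι]
    [DecidableEq α] (S : Finset (ι × α)) :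
    #(univ.filter fun s : ι × Sym2 α => ¬ s.2.IsDiag ∧ ∃ w ∈ S, w.1 = s.1 ∧ w.2 ∈ s.2) +
      ∑ l, (#(S.filter fun w => w.1 = l)).choose 2 = #S * (Fintype.card α - 1) := by
  induction S using Finset.induction_on with
  | empty => simp
  | insert v S hv ih =>
    have hdisj : Disjoint
        (univ.filter fun s : ι × Sym2 α => ¬ s.2.IsDiag ∧ ∃ w ∈ S, w.1 = s.1 ∧ w.2 ∈ s.2)
        ((univ.filter fun j : α => (v.1, j) ∉ insert v S).image fun j => (v.1, s(v.2, j))) := by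
      rw [Finset.disjoint_left]
      rintro s hs hs'
      simp only [mem_filter, mem_univ, true_and, mem_image] at hs hs'
      obtain ⟨j, hj, rfl⟩ := hs'
      obtain ⟨-, ⟨m, b⟩, hb, rfl, hmem⟩ := hs
      dsimp only at hb hmem
      rcases Sym2.mem_iff.mp hmem with rfl | rfl
      · exact hv hb
      · exact hj (mem_insert_of_mem hb)
    have himage : #((univ.filter fun j : α => (v.1, j) ∉ insert v S).image
        fun j => (v.1, s(v.2, j))) = #(univ.filter fun j : α => (v.1, j) ∉ insert v S) :=
      card_image_of_injective _ fun i j h =>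
        Sym2.congr_right.mp (Prod.mk.inj h).2
    have hcluster : #(univ.filter fun j : α => (v.1, j) ∈ insert v S) =
        #(S.filter fun w => w.1 = v.1) + 1 := by
      have h : (univ.filter fun j : α => (v.1, j) ∈ insert v S).image (Prod.mk v.1) =
          insert v (S.filter fun w => w.1 = v.1) := by
        ext ⟨m, b⟩
        simp only [mem_image, mem_filter, mem_univ, true_and, mem_insert, Prod.mk.injEq]
        constructor
        · rintro ⟨j, hj | hj, rfl, rfl⟩
          · exact Or.inl hj
          · exact Or.inr ⟨hj, rfl⟩
        · rintro (h | ⟨h, rfl⟩)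
          · exact ⟨b, Or.inl (by rw [← h]), by rw [← h], rfl⟩
          · exact ⟨b, Or.inr h, rfl, rfl⟩
      rw [← card_image_of_injective _ (Prod.mk_right_injective v.1), h,
        card_insert_of_notMem (by simp [hv])]
    have hcompl := card_filter_add_card_filter_not (s := (univ : Finset α))
      (fun j => (v.1, j) ∈ insert v S)
    have hchoose : ∀ l, (#((insert v S).filter fun w => w.1 = l)).choose 2 =
        (#(S.filter fun w => w.1 = l)).choose 2 +
          if v.1 = l then #(S.filter fun w => w.1 = l) else 0 := by
      intro l
      rw [filter_insert]
      split_ifs with h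
      · rw [card_insert_of_notMem (by simp [hv]), Nat.choose_succ_succ' _ 1, Nat.choose_one_right,
          add_comm]
      · rfl
    rw [filter_exists_mem_insert, card_union_of_disjoint hdisj, himage,
      sum_congr rfl fun l _ => hchoose l, sum_add_distrib, sum_ite_eq, if_pos (mem_univ _),
      card_insert_of_notMem hv, add_mul, one_mul]
    rw [card_univ] at hcompl
    omega

/-- In the Algorithm-1 storage structure, a set `S` of `k` nodes with contact vector `ω`
retrieves exactly `k(nI − 1) − Σ_l ω_l(ω_l − 1)/2` distinct coded symbols. -/
theorem algorithm1_retrieval_count (L nI : ℕ) (hL : 1 ≤ L) (hnI : 2 ≤ nI)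
    (stores : (Fin L × Fin nI) → (Fin L × {e : Sym2 (Fin nI) // ¬ e.IsDiag}) → Prop)
    (hstores : ∀ v s, stores v s ↔ (v.1 = s.1 ∧ v.2 ∈ s.2.val))
    (k : ℕ) (S : Finset (Fin L × Fin nI)) (hS : S.card = k)
    (ω : Fin L → ℕ) (hω : ∀ l, ω l = (S.filter (fun v => v.1 = l)).card) :
    (({s | ∃ v ∈ S, stores v s}.ncard : ℤ)) =
      (k : ℤ) * ((nI : ℤ) - 1) - ∑ l, ((ω l : ℤ) * ((ω l : ℤ) - 1)) / 2 := by
  have hcard : {s | ∃ v ∈ S, stores v s}.ncard =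
      (Finset.univ.filter fun s : Fin L × Sym2 (Fin nI) =>
        ¬ s.2.IsDiag ∧ ∃ w ∈ S, w.1 = s.1 ∧ w.2 ∈ s.2).card := by
    rw [← Set.ncard_coe_finset, ← Set.ncard_image_of_injective _
      (Function.injective_id.prodMap Subtype.val_injective)]
    congr 1
    ext ⟨l, e⟩
    simp only [hstores, Set.mem_image, Set.mem_ofPred_eq, Finset.coe_filter, Finset.mem_univ,
      true_and]
    constructor
    · rintro ⟨⟨m, f, hf⟩, h, heq⟩
      cases heq
      exact ⟨hf, h⟩
    · rintro ⟨he, h⟩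
      exact ⟨(l, ⟨e, he⟩), h, rfl⟩
  have hchoose : ∀ l, ((ω l : ℤ) * ((ω l : ℤ) - 1)) / 2 =
      (((S.filter fun w => w.1 = l).card.choose 2 : ℕ) : ℤ) := by
    intro l
    rw [← hω l, Nat.choose_two_right]
    cases ω l <;> simp
  have hcount := card_retrieved_add_sum_choose_two S
  rw [← hcard, hS, Fintype.card_fin] at hcount
  rw [Finset.sum_congr rfl fun l _ => hchoose l, eq_sub_iff_add_eq]
  have hpred : ((nI : ℤ) - 1) = ((nI - 1 : ℕ) : ℤ) := by omega
  rw [hpred]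
  exact_mod_cast hcount
end

section
/- (Lemma 2) In the Algorithm-2 storage structure with L ≥ 1, nI ≥ 2, n = L·nI and χ ≥ 1: (a) every coded symbol (global or local) is stored by exactly two distinct nodes; (b) any two nodes lying in different clusters store exactly one common coded symbol; (c) any two distinct nodes lying in the same cluster store exactly χ common coded symbols; (d) every node stores exactly (nI − 1)χ + (n − nI) coded symbols. -/
/-- Node `(l,j)` (0-indexed) of the clustered system is identified with element
`nI·l + j` of `{0,…,L·nI − 1}`. -/
def clusterIdx {L nI : ℕ} (v : Fin L × Fin nI) : Fin (L * nI) :=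
  ⟨nI * v.1.val + v.2.val, by
    have h1 : v.1.val + 1 ≤ L := v.1.isLt
    have h2 : v.2.val < nI := v.2.isLt
    calc nI * v.1.val + v.2.val < nI * v.1.val + nI := Nat.add_lt_add_left h2 _
      _ = nI * (v.1.val + 1) := by ring
      _ ≤ nI * L := Nat.mul_le_mul_left nI h1
      _ = L * nI := Nat.mul_comm nI L⟩

/-- The coded symbols of the Algorithm-2 storage structure: a global symbol for each edge
of the complete graph on the `n = L·nI` node indices, and a local symbol for each cluster
`l`, each `t ∈ {1,…,χ−1}` and each edge of the complete graph on `{1,…,nI}`. -/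
def AlgTwoSymbol (L nI χ : ℕ) : Type :=
  {e : Sym2 (Fin (L * nI)) // ¬ e.IsDiag} ⊕
    (Fin L × Fin (χ - 1) × {e : Sym2 (Fin nI) // ¬ e.IsDiag})

/-- Node `(l,j)` stores a global symbol `e` iff its index is an endpoint of `e`, and stores
a local symbol `(l',t,e')` iff `l = l'` and `j` is an endpoint of `e'`. -/
def algTwoStores {L nI χ : ℕ} (v : Fin L × Fin nI) (s : AlgTwoSymbol L nI χ) : Prop :=
  match s with
  | Sum.inl e => clusterIdx v ∈ e.val
  | Sum.inr w => v.1 = w.1 ∧ v.2 ∈ w.2.2.val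

theorem ncard_mem_of_not_isDiag {α : Type*} (e : {e : Sym2 α // ¬ e.IsDiag}) :
    {a | a ∈ e.val}.ncard = 2 := by
  obtain ⟨e, he⟩ := e
  induction e using Sym2.ind with
  | _ a b =>
    have hset : {c | c ∈ s(a, b)} = {a, b} := by ext c; simp
    rw [hset, Set.ncard_pair (by simpa using he)]

theorem ncard_edges_through_pair {α : Type*} {a b : α} (hab : a ≠ b) :
    {e : {e : Sym2 α // ¬ e.IsDiag} | a ∈ e.val ∧ b ∈ e.val}.ncard = 1 := by
  rw [Set.ncard_eq_one]
  refine ⟨⟨s(a, b), by simpa using hab⟩, ?_⟩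
  ext e
  simp [Subtype.ext_iff, Sym2.mem_and_mem_iff hab]

theorem ncard_edges_through {α : Type*} [Fintype α] (a : α) :
    {e : {e : Sym2 α // ¬ e.IsDiag} | a ∈ e.val}.ncard = Fintype.card α - 1 := by
  classical
  let f : {b : α // b ≠ a} → {e : Sym2 α // ¬ e.IsDiag} :=
    fun b => ⟨s(a, b.val), by simpa using b.property.symm⟩
  have hf : Function.Injective f := fun b c h =>
    Subtype.ext (Sym2.congr_right.mp (congrArg Subtype.val h))
  have hrange : {e : {e : Sym2 α // ¬ e.IsDiag} | a ∈ e.val} = Set.range f := by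
    ext ⟨e, he⟩
    constructor
    · rintro ⟨b, rfl⟩
      exact ⟨⟨b, fun h => he (by simp [h])⟩, rfl⟩
    · rintro ⟨b, hb⟩
      rw [← hb]
      exact Sym2.mem_mk_left a b.val
  rw [hrange, ← Set.image_univ, Set.ncard_image_of_injective _ hf, Set.ncard_univ,
    Nat.card_eq_fintype_card, Fintype.card_subtype_compl, Fintype.card_subtype_eq]

theorem Set.ncard_eq_ncard_preimage_inl_add_inr {α β : Type*} [Finite α] [Finite β]
    (S : Set (α ⊕ β)) : S.ncard = (Sum.inl ⁻¹' S).ncard + (Sum.inr ⁻¹' S).ncard := by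
  conv_lhs => rw [← Set.image_preimage_inl_union_image_preimage_inr S]
  rw [Set.ncard_union_eq Set.disjoint_image_inl_image_inr,
    Set.ncard_image_of_injective _ Sum.inl_injective,
    Set.ncard_image_of_injective _ Sum.inr_injective]

theorem clusterIdx_bijective (L nI : ℕ) :
    Function.Bijective (clusterIdx : Fin L × Fin nI → Fin (L * nI)) := by
  have h : (clusterIdx : Fin L × Fin nI → Fin (L * nI)) = finProdFinEquiv := by
    funext v
    exact Fin.ext (Nat.add_comm _ _)
  rw [h]
  exact finProdFinEquiv.bijective

theorem ncard_singleton_prod_univ_prod {α β γ : Type*} (a : α) (S : Set γ) :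
    {w : α × β × γ | a = w.1 ∧ w.2.2 ∈ S}.ncard = Nat.card β * S.ncard := by
  have hset : {w : α × β × γ | a = w.1 ∧ w.2.2 ∈ S} = {a} ×ˢ (Set.univ ×ˢ S) := by
    ext w
    simp [eq_comm]
  rw [hset, Set.ncard_prod, Set.ncard_prod, Set.ncard_singleton, Set.ncard_univ, one_mul]

theorem ncard_nodes_storing {L nI χ : ℕ} (s : AlgTwoSymbol L nI χ) :
    {v | algTwoStores v s}.ncard = 2 := by
  rcases s with e | ⟨l, t, e⟩
  · change (clusterIdx ⁻¹' {a | a ∈ e.val}).ncard = 2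
    rw [Set.ncard_preimage_of_injective_subset_range (clusterIdx_bijective L nI).injective
      (by simp [(clusterIdx_bijective L nI).surjective.range_eq]), ncard_mem_of_not_isDiag]
  · have hset : {v | algTwoStores v (Sum.inr (l, t, e) : AlgTwoSymbol L nI χ)} =
        {l} ×ˢ {j | j ∈ e.val} := by
      ext v
      rfl
    rw [hset, Set.ncard_prod, Set.ncard_singleton, ncard_mem_of_not_isDiag]

theorem ncard_stored_symbols {L nI χ : ℕ} (v : Fin L × Fin nI) :
    {s : AlgTwoSymbol L nI χ | algTwoStores v s}.ncard =
      (L * nI - 1) + (χ - 1) * (nI - 1) := by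
  have hglobal := ncard_edges_through (clusterIdx v)
  have hlocal := ncard_singleton_prod_univ_prod (β := Fin (χ - 1)) v.1
    {e : {e : Sym2 (Fin nI) // ¬ e.IsDiag} | v.2 ∈ e.val}
  rw [ncard_edges_through] at hlocal
  simp only [Fintype.card_fin, Nat.card_eq_fintype_card] at hglobal hlocal
  exact (Set.ncard_eq_ncard_preimage_inl_add_inr _).trans (congrArg₂ (· + ·) hglobal hlocal)

theorem ncard_common_symbols {L nI χ : ℕ} {v u : Fin L × Fin nI} (hvu : v ≠ u) :
    ({s : AlgTwoSymbol L nI χ | algTwoStores v s} ∩ {s | algTwoStores u s}).ncard =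
      1 + {w : Fin L × Fin (χ - 1) × {e : Sym2 (Fin nI) // ¬ e.IsDiag} |
        (v.1 = w.1 ∧ v.2 ∈ w.2.2.val) ∧ (u.1 = w.1 ∧ u.2 ∈ w.2.2.val)}.ncard := by
  have hglobal := ncard_edges_through_pair ((clusterIdx_bijective L nI).injective.ne hvu)
  exact (Set.ncard_eq_ncard_preimage_inl_add_inr _).trans (congrArg (· + _) hglobal)

/-- Lemma 2: in the Algorithm-2 storage structure, (a) every coded symbol is stored by
exactly two nodes, (b) nodes in different clusters share exactly one symbol, (c) distinct
nodes in the same cluster share exactly `χ` symbols, (d) every node stores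
`(nI − 1)χ + (n − nI)` symbols. -/
theorem algorithm2_storage_properties (L nI χ : ℕ) (hL : 1 ≤ L) (hnI : 2 ≤ nI) (hχ : 1 ≤ χ) :
    (∀ s : AlgTwoSymbol L nI χ, {v | algTwoStores v s}.ncard = 2) ∧
    (∀ v u : Fin L × Fin nI, v.1 ≠ u.1 →
      ({s : AlgTwoSymbol L nI χ | algTwoStores v s} ∩ {s | algTwoStores u s}).ncard = 1) ∧
    (∀ v u : Fin L × Fin nI, v ≠ u → v.1 = u.1 →
      ({s : AlgTwoSymbol L nI χ | algTwoStores v s} ∩ {s | algTwoStores u s}).ncard = χ) ∧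
    (∀ v : Fin L × Fin nI,
      {s : AlgTwoSymbol L nI χ | algTwoStores v s}.ncard = (nI - 1) * χ + (L * nI - nI)) := by
  refine ⟨ncard_nodes_storing, fun v u hvu => ?_, fun v u hvu hl => ?_, fun v => ?_⟩
  · have hempty : {w : Fin L × Fin (χ - 1) × {e : Sym2 (Fin nI) // ¬ e.IsDiag} |
        (v.1 = w.1 ∧ v.2 ∈ w.2.2.val) ∧ (u.1 = w.1 ∧ u.2 ∈ w.2.2.val)} = ∅ :=
      Set.eq_empty_of_forall_notMem fun w hw => hvu (hw.1.1.trans hw.2.1.symm)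
    rw [ncard_common_symbols (ne_of_apply_ne Prod.fst hvu), hempty, Set.ncard_empty]
  · have hset : {w : Fin L × Fin (χ - 1) × {e : Sym2 (Fin nI) // ¬ e.IsDiag} |
        (v.1 = w.1 ∧ v.2 ∈ w.2.2.val) ∧ (u.1 = w.1 ∧ u.2 ∈ w.2.2.val)} =
        {w | v.1 = w.1 ∧ w.2.2 ∈ {e : {e : Sym2 (Fin nI) // ¬ e.IsDiag} |
          v.2 ∈ e.val ∧ u.2 ∈ e.val}} := by
      ext w
      simp only [Set.mem_ofPred_eq, ← hl]
      tauto
    rw [ncard_common_symbols hvu, hset, ncard_singleton_prod_univ_prod,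
      ncard_edges_through_pair fun h => hvu (Prod.ext hl h), Nat.card_eq_fintype_card,
      Fintype.card_fin]
    omega
  · rw [ncard_stored_symbols]
    obtain ⟨k, rfl⟩ := Nat.exists_eq_add_of_le' hχ
    have hle : nI ≤ L * nI := Nat.le_mul_of_pos_left nI hL
    rw [Nat.add_sub_cancel, Nat.mul_succ, Nat.mul_comm k]
    omega
end

section
/- In the Algorithm-2 storage structure with L ≥ 1, nI ≥ 2, n = L·nI and χ ≥ 1, set α = (nI − 1)χ + (n − nI). Let S be any set of k distinct nodes and for each l ∈ {1,…,L} let ω_l be the number of nodes of S in cluster l. Then the number of distinct coded symbols stored on at least one node of S equals k·α − k(k−1)/2 − (χ−1)·Σ_{l=1}^{L} ω_l(ω_l − 1)/2. -/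
theorem ncard_edges_meeting {V : Type*} [Fintype V] (T : Finset V) :
    ({e : {e : Sym2 V // ¬ e.IsDiag} | ∃ v ∈ T, v ∈ e.val}.ncard : ℤ) =
      (T.card : ℤ) * (Fintype.card V - 1) - (T.card : ℤ) * ((T.card : ℤ) - 1) / 2 := by
  classical
  have hsub : Tᶜ.offDiag.image Sym2.mk.uncurry ⊆
      (Finset.univ : Finset V).offDiag.image Sym2.mk.uncurry :=
    Finset.image_subset_image (Finset.offDiag_mono (Finset.subset_univ _))
  have himage : Subtype.val '' {e : {e : Sym2 V // ¬ e.IsDiag} | ∃ v ∈ T, v ∈ e.val} =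
      (((Finset.univ : Finset V).offDiag.image Sym2.mk.uncurry \
        Tᶜ.offDiag.image Sym2.mk.uncurry : Finset (Sym2 V)) : Set (Sym2 V)) := by
    ext e
    induction e with | _ a b
    have hmem (s : Finset V) :
        s(a, b) ∈ s.offDiag.image Sym2.mk.uncurry ↔ a ∈ s ∧ b ∈ s ∧ a ≠ b := by
      simp only [Finset.mem_image, Finset.mem_offDiag, Prod.exists, Function.uncurry_apply_pair,
        Sym2.eq_iff]
      constructor
      · rintro ⟨x, y, ⟨hx, hy, hxy⟩, ⟨rfl, rfl⟩ | ⟨rfl, rfl⟩⟩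
        exacts [⟨hx, hy, hxy⟩, ⟨hy, hx, hxy.symm⟩]
      · exact fun h => ⟨a, b, h, Or.inl ⟨rfl, rfl⟩⟩
    rw [Finset.mem_coe, Finset.mem_sdiff, hmem, hmem]
    simp only [Set.mem_image, Set.mem_ofPred_eq, Subtype.exists, exists_and_right, exists_eq_right,
      Sym2.mk_isDiag_iff, Sym2.mem_iff, Finset.mem_univ, Finset.mem_compl]
    grind
  rw [← Set.ncard_image_of_injective _ Subtype.val_injective, himage, Set.ncard_coe_finset,
    Finset.card_sdiff_of_subset hsub, Nat.cast_sub (Finset.card_le_card hsub)]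
  have hcard (s : Finset V) :
      (s.offDiag.image Sym2.mk.uncurry).card = s.card.choose 2 := Sym2.card_image_offDiag s
  have hdouble (m : ℕ) : 2 * ((m.choose 2 : ℕ) : ℤ) = m * (m - 1) := by
    have h := Nat.cast_choose_two ℚ m
    have h' : (2 : ℚ) * (m.choose 2 : ℕ) = m * (m - 1) := by rw [h]; ring
    exact_mod_cast h'
  have hhalf : (T.card : ℤ) * ((T.card : ℤ) - 1) / 2 = (T.card.choose 2 : ℕ) := by
    rw [← hdouble]; simp
  rw [hhalf, hcard, hcard, Finset.card_univ]
  have h1 := hdouble (Fintype.card V)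
  have h2 := hdouble Tᶜ.card
  have h3 := hdouble T.card
  have h4 : (Tᶜ.card : ℤ) = Fintype.card V - T.card := by
    rw [Finset.card_compl, Nat.cast_sub (Finset.card_le_univ T)]
  rw [h4] at h2
  linarith

theorem clusterIdx_injective {L nI : ℕ} :
    Function.Injective (clusterIdx : Fin L × Fin nI → Fin (L * nI)) := by
  rintro ⟨a, b⟩ ⟨c, d⟩ h
  have h' : nI * a.val + b.val = nI * c.val + d.val := congrArg Fin.val h
  have hpos : 0 < nI := b.pos
  have hq := congrArg (· / nI) h'
  have hr := congrArg (· % nI) h'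
  simp only [Nat.mul_add_div hpos, Nat.mul_add_mod, Nat.div_eq_of_lt b.isLt,
    Nat.div_eq_of_lt d.isLt, Nat.mod_eq_of_lt b.isLt, Nat.mod_eq_of_lt d.isLt] at hq hr
  exact Prod.ext (Fin.ext hq) (Fin.ext hr)

theorem ncard_prod_fibers {ι τ β : Type*} [Fintype ι] [Finite τ] [Finite β]
    (A : ι → Set β) :
    {w : ι × τ × β | w.2.2 ∈ A w.1}.ncard = ∑ i, Nat.card τ * (A i).ncard := by
  let f : {w : ι × τ × β | w.2.2 ∈ A w.1} ≃ Σ i, τ × A i :=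
    { toFun := fun w => ⟨w.1.1, w.1.2.1, w.1.2.2, w.2⟩
      invFun := fun w => ⟨(w.1, w.2.1, w.2.2.1), w.2.2.2⟩
      left_inv := fun _ => rfl
      right_inv := fun _ => rfl }
  rw [← Nat.card_coe_set_eq, Nat.card_congr f, Nat.card_sigma]
  simp [Nat.card_prod]

/-- In the Algorithm-2 storage structure with `α = (nI−1)χ + (n−nI)`, a set `S` of `k`
nodes with contact vector `ω` retrieves exactly
`kα − k(k−1)/2 − (χ−1) Σ_l ω_l(ω_l−1)/2` distinct coded symbols. -/
theorem algorithm2_retrieval_count (L nI χ : ℕ) (hL : 1 ≤ L) (hnI : 2 ≤ nI) (hχ : 1 ≤ χ)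
    (n : ℕ) (hn : n = L * nI) (α : ℕ) (hα : α = (nI - 1) * χ + (n - nI))
    (k : ℕ) (S : Finset (Fin L × Fin nI)) (hS : S.card = k)
    (ω : Fin L → ℕ) (hω : ∀ l, ω l = (S.filter (fun v => v.1 = l)).card) :
    (({s : AlgTwoSymbol L nI χ | ∃ v ∈ S, algTwoStores v s}.ncard : ℤ)) =
      (k : ℤ) * (α : ℤ) - (k : ℤ) * ((k : ℤ) - 1) / 2 -
        ((χ : ℤ) - 1) * ∑ l, ((ω l : ℤ) * ((ω l : ℤ) - 1)) / 2 := by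
  classical
  let T : Fin L → Finset (Fin nI) := fun l => (S.filter (fun v => v.1 = l)).image Prod.snd
  have hT (l : Fin L) : (T l).card = ω l := by
    rw [hω, Finset.card_image_of_injOn]
    rintro ⟨a, b⟩ h ⟨c, d⟩ h' hbd
    simp_all
  have hglobal := ncard_edges_meeting (S.image clusterIdx)
  rw [Finset.card_image_of_injective _ clusterIdx_injective, hS, Fintype.card_fin] at hglobal
  have hlocal := ncard_prod_fibers (τ := Fin (χ - 1))
    (fun l => {e : {e : Sym2 (Fin nI) // ¬ e.IsDiag} | ∃ v ∈ T l, v ∈ e.val})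
  have hsplit : {s : AlgTwoSymbol L nI χ | ∃ v ∈ S, algTwoStores v s} =
      Sum.inl '' {e : {e : Sym2 (Fin (L * nI)) // ¬ e.IsDiag} |
        ∃ v ∈ S.image clusterIdx, v ∈ e.val} ∪
      Sum.inr '' {w : Fin L × Fin (χ - 1) × {e : Sym2 (Fin nI) // ¬ e.IsDiag} |
        w.2.2 ∈ {e : {e : Sym2 (Fin nI) // ¬ e.IsDiag} | ∃ v ∈ T w.1, v ∈ e.val}} := by
    ext s
    rcases s with e | ⟨l, t, e⟩
    · constructor
      · rintro ⟨v, hv, h⟩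
        exact Or.inl ⟨e, ⟨_, Finset.mem_image_of_mem _ hv, h⟩, rfl⟩
      · rintro (⟨_, ⟨_, h, he⟩, heq⟩ | ⟨_, _, heq⟩)
        · obtain ⟨v, hv, rfl⟩ := Finset.mem_image.1 h
          cases heq
          exact ⟨v, hv, he⟩
        · cases heq
    · constructor
      · rintro ⟨v, hv, h, he⟩
        exact Or.inr ⟨(l, t, e),
          ⟨_, Finset.mem_image_of_mem _ (Finset.mem_filter.2 ⟨hv, h⟩), he⟩, rfl⟩
      · rintro (⟨_, _, heq⟩ | ⟨_, ⟨_, h, he⟩, heq⟩)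
        · cases heq
        · obtain ⟨v, hv, rfl⟩ := Finset.mem_image.1 h
          cases heq
          exact ⟨v, (Finset.mem_filter.1 hv).1, (Finset.mem_filter.1 hv).2, he⟩
  have hdisj : Disjoint
      (Sum.inl '' {e : {e : Sym2 (Fin (L * nI)) // ¬ e.IsDiag} |
        ∃ v ∈ S.image clusterIdx, v ∈ e.val})
      (Sum.inr '' {w : Fin L × Fin (χ - 1) × {e : Sym2 (Fin nI) // ¬ e.IsDiag} |
        w.2.2 ∈ {e : {e : Sym2 (Fin nI) // ¬ e.IsDiag} | ∃ v ∈ T w.1, v ∈ e.val}}) :=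
    Set.disjoint_image_inl_image_inr
  have hsum : ∑ l, (ω l : ℤ) = k := by
    rw [← hS, Finset.card_eq_sum_card_fiberwise (f := Prod.fst) (t := Finset.univ) (by simp)]
    simp [hω]
  have hαz : (α : ℤ) = ((L * nI : ℕ) - 1) + (χ - 1) * (nI - 1) := by
    have hle : nI ≤ L * nI := Nat.le_mul_of_pos_left nI hL
    rw [hα, hn]
    push_cast [Nat.cast_sub hle, Nat.cast_sub (show 1 ≤ nI by omega)]
    ring
  have hunion := Set.ncard_union_eq hdisj (Set.toFinite _) (Set.toFinite _)
  rw [Set.ncard_image_of_injective _ Sum.inl_injective,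
    Set.ncard_image_of_injective _ Sum.inr_injective, hlocal] at hunion
  have hcount := (congrArg Set.ncard hsplit).trans hunion
  rw [hcount, Nat.cast_add, hglobal, Nat.cast_sum]
  simp only [Nat.cast_mul, ncard_edges_meeting, hT, Nat.card_fin, Fintype.card_fin]
  rw [← Finset.mul_sum, Finset.sum_sub_distrib, ← Finset.sum_mul, hsum, hαz, Nat.cast_sub hχ]
  push_cast
  ring
end

section
/- (Theorem 6, exact regeneration) In the Algorithm-3 storage structure (see context) with k ≥ 1, L ≥ 2, n = kL: for every node t belonging to cluster l and every bijection φ from the set of the n − k nodes outside cluster l onto {1,…,n−k}, the source messages s_1,…,s_{n−k} — and hence the entire content of node t — are uniquely determined by the full contents of the k − 1 other nodes of cluster l together with, for each node u outside cluster l, the single symbol C_{φ(u)}(s_{φ(u)})_u. Formally: if two families of messages (s_i) and (s'_i) in (F^k)^{n−k} produce equal values for all the symbols {C_i(s_i)_v : v in cluster l, v ≠ t, i ∈ {1,…,n−k}} and {C_{φ(u)}(s_{φ(u)})_u : u outside cluster l}, then s_i = s'_i for all i. Hence a failed node is exactly regenerated with intra-cluster repair bandwidth β_I = n − k symbols from each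 of the k − 1 nodes of its cluster and cross-cluster repair bandwidth β_c = 1 symbol from each of the n − k nodes of other clusters. -/
theorem Fin.card_filter_val_div_eq {k L n : ℕ} (hn : n = k * L) (t : Fin n) :
    (Finset.univ.filter fun v : Fin n => v.val / k = t.val / k).card = k := by
  have ht : t.val < k * L := t.isLt.trans_eq hn
  have hk : 0 < k := Nat.pos_of_mul_pos_right (Nat.zero_lt_of_lt ht)
  have hq : t.val / k + 1 ≤ L := Nat.div_lt_of_lt_mul ht
  have hmul : k * (t.val / k + 1) ≤ n := (Nat.mul_le_mul_left k hq).trans_eq hn.symm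
  have hbound : ∀ j : Fin k, k * (t.val / k) + j.val < n := fun j => by
    have := j.isLt
    rw [Nat.mul_add] at hmul
    omega
  conv_rhs => rw [← Finset.card_fin k]
  symm
  refine Finset.card_bij (fun j _ => ⟨k * (t.val / k) + j.val, hbound j⟩) ?_ ?_ ?_
  · intro j _
    simp [Nat.mul_add_div hk, Nat.div_eq_of_lt j.isLt]
  · intro a _ b _ h
    simpa [Fin.ext_iff] using h
  · intro v hv
    have hv' : v.val / k = t.val / k := by simpa using hv
    refine ⟨⟨v.val % k, Nat.mod_lt _ hk⟩, Finset.mem_univ _, Fin.ext ?_⟩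
    simpa [hv'] using Nat.div_add_mod v.val k

/-- Theorem 6 (exact regeneration): in the Algorithm-3 storage structure with `n = kL`
(node `t : Fin n` belongs to cluster `t.val / k`), the content of any node `t` is uniquely
determined by the full contents of the other `k − 1` nodes of its cluster together with,
for each node `u` outside the cluster, the single symbol `C_{φ(u)}(s_{φ(u)})_u`, where `φ`
is any bijection from the nodes outside cluster `t` onto `{1,…,n−k}`.  Hence a failed node
is regenerated with `β_I = n − k` and `β_c = 1`. -/
theorem algorithm3_exact_regeneration (k L : ℕ) (hk : 1 ≤ k) (hL : 2 ≤ L)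
    (n : ℕ) (hn : n = k * L)
    (F : Type*) (C : Fin (n - k) → (Fin k → F) → (Fin n → F))
    (hMDS : ∀ (i : Fin (n - k)) (S : Finset (Fin n)), S.card = k →
      Function.Injective (fun s : Fin k → F => fun v : {x // x ∈ S} => C i s v.val)) :
    ∀ t : Fin n, ∀ φ : {u : Fin n // u.val / k ≠ t.val / k} ≃ Fin (n - k),
      ∀ s s' : Fin (n - k) → Fin k → F,
        (∀ v : Fin n, v.val / k = t.val / k → v ≠ t →
          ∀ i : Fin (n - k), C i (s i) v = C i (s' i) v) →
        (∀ u : {u : Fin n // u.val / k ≠ t.val / k},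
          C (φ u) (s (φ u)) u.val = C (φ u) (s' (φ u)) u.val) →
        s = s' := by
  intro t φ s s' hintra hcross
  funext i
  obtain ⟨u, rfl⟩ := φ.surjective i
  let A := Finset.univ.filter fun v : Fin n => v.val / k = t.val / k
  have hu : u.val ∉ A.erase t := fun h => u.property (by simpa [A] using Finset.mem_of_mem_erase h)
  have hcard : (insert u.val (A.erase t)).card = k := by
    rw [Finset.card_insert_of_notMem hu, Finset.card_erase_of_mem (by simp [A]),
      Fin.card_filter_val_div_eq hn t]
    omega
  apply hMDS (φ u) _ hcard
  funext ⟨v, hv⟩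
  rcases Finset.mem_insert.mp hv with rfl | hv
  · exact hcross u
  · obtain ⟨hne, hmem⟩ := Finset.mem_erase.mp hv
    exact hintra v (by simpa [A] using hmem) hne (φ u)
end
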